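/- In an S2 topology with L spaces and switch set S, let d be any integer with 1 ≤ d ≤ L and fix a destination switch t. Consider greedy routing with respect to the d-MCD: whenever s_j ≠ t, the next switch s_{j+1} is a graph neighbor of s_j minimizing MCD_d(χ(·), χ(t)) among all graph neighbors of s_j. Then for every starting switch s_0 the sequence reaches t after at most |S| − 1 hops and visits pairwise distinct switches; that is, for every d with 1 ≤ d ≤ L, greedy routing using the d-MCD provides delivery guarantee and loop-freedom. -/

import Mathlib

/-- Circular distance on the unit circle `[0,1)` with circumference 1. -/
noncomputable def CD (x y : ℝ) : ℝ := min |x - y| (1 - |x - y|)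

/-- `inArc a b c` : the point `c` lies strictly inside the open circular arc
going from `a` in the positive direction to `b` (coordinates mod 1). -/
def inArc (a b c : ℝ) : Prop :=
  0 < Int.fract (c - a) ∧ Int.fract (c - a) < Int.fract (b - a)

/-- Two points `p ≠ q` of a set `Q` of coordinates are circularly (ring-)adjacent in `Q`
if one of the two open circular arcs between them contains no point of `Q`. -/
def RingAdj (Q : Set ℝ) (p q : ℝ) : Prop :=
  p ∈ Q ∧ q ∈ Q ∧ p ≠ q ∧
    ((∀ r ∈ Q, ¬ inArc p q r) ∨ (∀ r ∈ Q, ¬ inArc q p r))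

/-- `d`-MCD: minimum circular distance over the first `d` spaces, between an
`L`-dimensional coordinate vector `X` and a `d`-dimensional target `Y`. -/
noncomputable def MCDd {L : ℕ} (d : ℕ) (hd : d ≤ L) (X : Fin L → ℝ) (Y : Fin d → ℝ) : ℝ :=
  ⨅ i : Fin d, CD (X (Fin.castLE hd i)) (Y i)

theorem fract_sub_cases {x y : ℝ} (hx : x ∈ Set.Ico (0:ℝ) 1) (hy : y ∈ Set.Ico (0:ℝ) 1) :
    (y ≤ x ∧ Int.fract (x - y) = x - y) ∨ (x < y ∧ Int.fract (x - y) = x - y + 1) := by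
  obtain ⟨h1, h2⟩ := hx
  obtain ⟨h3, h4⟩ := hy
  rcases le_or_gt y x with h | h
  · exact Or.inl ⟨h, Int.fract_eq_self.2 ⟨by linarith, by linarith⟩⟩
  · refine Or.inr ⟨h, ?_⟩
    rw [← Int.fract_add_one]
    exact Int.fract_eq_self.2 ⟨by linarith, by linarith⟩

theorem CD_eq_fract {x y : ℝ} (hx : x ∈ Set.Ico (0:ℝ) 1) (hy : y ∈ Set.Ico (0:ℝ) 1) (hne : x ≠ y) :
    CD x y = min (Int.fract (x - y)) (Int.fract (y - x)) := by
  unfold CD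
  rcases lt_or_gt_of_ne hne with h | h
  · rw [abs_of_neg (by linarith)]
    rcases fract_sub_cases hx hy with ⟨a, b⟩ | ⟨a, b⟩ <;>
    rcases fract_sub_cases hy hx with ⟨c, e⟩ | ⟨c, e⟩ <;> try linarith
    rw [b, e, min_comm]; congr 1 <;> ring
  · rw [abs_of_pos (by linarith)]
    rcases fract_sub_cases hx hy with ⟨a, b⟩ | ⟨a, b⟩ <;>
    rcases fract_sub_cases hy hx with ⟨c, e⟩ | ⟨c, e⟩ <;> try linarith
    rw [b, e]; congr 1; ring

theorem CD_le_fract {x y : ℝ} (hx : x ∈ Set.Ico (0:ℝ) 1) (hy : y ∈ Set.Ico (0:ℝ) 1) :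
    CD x y ≤ Int.fract (x - y) ∧ CD x y ≤ Int.fract (y - x) := by
  by_cases h : x = y
  · subst h; simp [CD]
  · rw [CD_eq_fract hx hy h]; exact ⟨min_le_left _ _, min_le_right _ _⟩

/-- In one space, some ring neighbour is strictly closer. -/
theorem exists_closer {S : Type*} [Fintype S] (c : S → ℝ)
    (hmem : ∀ s, c s ∈ Set.Ico (0:ℝ) 1) (hinj : Function.Injective c) (s t : S) (hst : s ≠ t) :
    ∃ u, s ≠ u ∧ RingAdj (Set.range c) (c s) (c u) ∧ CD (c u) (c t) < CD (c s) (c t) := by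
  classical
  have hne : (Finset.univ.erase s).Nonempty := ⟨t, by simp [hst.symm]⟩
  have hc : c s ≠ c t := fun h => hst (hinj h)
  rw [CD_eq_fract (hmem s) (hmem t) hc]
  rcases le_total (Int.fract (c s - c t)) (Int.fract (c t - c s)) with hle | hle
  · rw [min_eq_left hle]
    obtain ⟨u, hu, hmin⟩ := Finset.exists_min_image _ (fun u => Int.fract (c s - c u)) hne
    have hus : u ≠ s := by simpa using hu
    have hcu : c s ≠ c u := fun h => hus (hinj h).symm
    refine ⟨u, hus.symm, ⟨⟨s, rfl⟩, ⟨u, rfl⟩, hcu, Or.inr ?_⟩, ?_⟩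
    · rintro _ ⟨r, rfl⟩ ⟨h1, h2⟩
      have hrs : r ≠ s := by rintro rfl; exact lt_irrefl _ h2
      have h3 := hmin r (by simp [hrs])
      rcases fract_sub_cases (hmem s) (hmem u) with ⟨a, b⟩ | ⟨a, b⟩ <;>
      rcases fract_sub_cases (hmem r) (hmem u) with ⟨a', b'⟩ | ⟨a', b'⟩ <;>
      rcases fract_sub_cases (hmem s) (hmem r) with ⟨a'', b''⟩ | ⟨a'', b''⟩ <;>
      rw [b'] at h1 h2 <;> rw [b] at h2 h3 <;> rw [b''] at h3 <;>
      linarith [(hmem s).1, (hmem s).2, (hmem u).1, (hmem u).2, (hmem r).1, (hmem r).2]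
    · refine lt_of_le_of_lt (CD_le_fract (hmem u) (hmem t)).1 ?_
      have h3 := hmin t (by simp [hst.symm])
      have h4 := lt_or_gt_of_ne hcu
      rcases fract_sub_cases (hmem s) (hmem u) with ⟨a, b⟩ | ⟨a, b⟩ <;>
      rcases fract_sub_cases (hmem u) (hmem t) with ⟨a', b'⟩ | ⟨a', b'⟩ <;>
      rcases fract_sub_cases (hmem s) (hmem t) with ⟨a'', b''⟩ | ⟨a'', b''⟩ <;>
      rw [b', b''] <;> rw [b, b''] at h3 <;> rcases h4 with h4 | h4 <;>
      linarith [(hmem s).1, (hmem s).2, (hmem u).1, (hmem u).2, (hmem t).1, (hmem t).2]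
  · rw [min_eq_right hle]
    obtain ⟨u, hu, hmin⟩ := Finset.exists_min_image _ (fun u => Int.fract (c u - c s)) hne
    have hus : u ≠ s := by simpa using hu
    have hcu : c s ≠ c u := fun h => hus (hinj h).symm
    refine ⟨u, hus.symm, ⟨⟨s, rfl⟩, ⟨u, rfl⟩, hcu, Or.inl ?_⟩, ?_⟩
    · rintro _ ⟨r, rfl⟩ ⟨h1, h2⟩
      have hrs : r ≠ s := by rintro rfl; simp at h1
      exact absurd h2 (not_lt.2 (hmin r (by simp [hrs])))
    · refine lt_of_le_of_lt (CD_le_fract (hmem u) (hmem t)).2 ?_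
      have h3 := hmin t (by simp [hst.symm])
      have h4 := lt_or_gt_of_ne hcu
      rcases fract_sub_cases (hmem u) (hmem s) with ⟨a, b⟩ | ⟨a, b⟩ <;>
      rcases fract_sub_cases (hmem t) (hmem u) with ⟨a', b'⟩ | ⟨a', b'⟩ <;>
      rcases fract_sub_cases (hmem t) (hmem s) with ⟨a'', b''⟩ | ⟨a'', b''⟩ <;>
      rw [b', b''] <;> rw [b, b''] at h3 <;> rcases h4 with h4 | h4 <;>
      linarith [(hmem s).1, (hmem s).2, (hmem u).1, (hmem u).2, (hmem t).1, (hmem t).2]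

/-- In an S2 topology with `L` spaces, for every `d` with `1 ≤ d ≤ L`,
greedy routing using the `d`-MCD toward a destination switch `t` (whenever the current
switch differs from `t`, the next switch is a graph neighbor minimizing the `d`-MCD to
the coordinates of `t` among all graph neighbors) reaches `t` within `|S| - 1` hops and
visits pairwise distinct switches. -/
theorem stmt_4 {S : Type*} [Fintype S] {L : ℕ}
    (χ : Fin L → S → ℝ)
    (hmem : ∀ (i : Fin L) (s : S), χ i s ∈ Set.Ico (0 : ℝ) 1)
    (hinj : ∀ i : Fin L, Function.Injective (χ i))
    (G : SimpleGraph S)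
    (hG : ∀ (i : Fin L) (u v : S), u ≠ v →
      RingAdj (Set.range (χ i)) (χ i u) (χ i v) → G.Adj u v)
    (d : ℕ) (hd1 : 1 ≤ d) (hd2 : d ≤ L)
    (t : S) (seq : ℕ → S)
    (hstep : ∀ j : ℕ, seq j ≠ t →
      G.Adj (seq j) (seq (j + 1)) ∧
      ∀ u : S, G.Adj (seq j) u →
        MCDd d hd2 (fun i => χ i (seq (j + 1))) (fun i => χ (Fin.castLE hd2 i) t) ≤
          MCDd d hd2 (fun i => χ i u) (fun i => χ (Fin.castLE hd2 i) t)) :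
    ∃ k : ℕ, k ≤ Fintype.card S - 1 ∧ seq k = t ∧
      ∀ j₁ j₂ : ℕ, j₁ ≤ k → j₂ ≤ k → seq j₁ = seq j₂ → j₁ = j₂ := by
  classical
  have hlt : ∀ j, seq j ≠ t →
      MCDd d hd2 (fun i => χ i (seq (j + 1))) (fun i => χ (Fin.castLE hd2 i) t) <
        MCDd d hd2 (fun i => χ i (seq j)) (fun i => χ (Fin.castLE hd2 i) t) := by
    intro j hj
    have : Nonempty (Fin d) := ⟨⟨0, hd1⟩⟩
    obtain ⟨i, hi⟩ := exists_eq_ciInf_of_finite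
      (f := fun i : Fin d => CD (χ (Fin.castLE hd2 i) (seq j)) (χ (Fin.castLE hd2 i) t))
    obtain ⟨u, hu1, hu2, hu3⟩ := exists_closer (χ (Fin.castLE hd2 i)) (hmem _) (hinj _) _ _ hj
    refine lt_of_le_of_lt ((hstep j hj).2 u (hG _ _ _ hu1 hu2)) ?_
    unfold MCDd
    refine lt_of_le_of_lt (ciInf_le (Set.finite_range _).bddBelow i) ?_
    exact lt_of_lt_of_eq hu3 hi
  generalize hf : (fun s => MCDd d hd2 (fun i => χ i s) (fun i => χ (Fin.castLE hd2 i) t)) = f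
    at *
  have hlt' : ∀ j, seq j ≠ t → f (seq (j + 1)) < f (seq j) := by
    intro j hj; rw [← hf]; exact hlt j hj
  have mono : ∀ a n, (∀ j, j < a + n + 1 → seq j ≠ t) → f (seq (a + n + 1)) < f (seq a) := by
    intro a n
    induction n with
    | zero => intro h; exact hlt' a (h a (by omega))
    | succ n ih =>
      intro h
      exact (hlt' (a + n + 1) (h _ (by omega))).trans (ih fun j hj => h j (by omega))
  have inj : ∀ k, (∀ j, j < k → seq j ≠ t) →
      ∀ j₁ j₂ : ℕ, j₁ ≤ k → j₂ ≤ k → seq j₁ = seq j₂ → j₁ = j₂ := by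
    intro k hk j₁ j₂ h1 h2 he
    rcases lt_trichotomy j₁ j₂ with h | h | h
    · obtain ⟨n, rfl⟩ := Nat.exists_eq_add_of_lt h
      have := mono j₁ n fun j hj => hk j (by omega)
      rw [he] at this; exact absurd this (lt_irrefl _)
    · exact h
    · obtain ⟨n, rfl⟩ := Nat.exists_eq_add_of_lt h
      have := mono j₂ n fun j hj => hk j (by omega)
      rw [he] at this; exact absurd this (lt_irrefl _)
  have hex : ∃ k, seq k = t := by
    by_contra hno
    push Not at hno
    exact not_injective_infinite_finite seq fun a b hab =>
      inj (max a b) (fun j _ => hno j) a b (le_max_left _ _) (le_max_right _ _) hab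
  have hI := inj (Nat.find hex) (fun j hj => Nat.find_min hex hj)
  refine ⟨Nat.find hex, ?_, Nat.find_spec hex, hI⟩
  have := Fintype.card_le_of_injective (fun j : Fin (Nat.find hex + 1) => seq j)
    (fun a b hab => Fin.ext (hI a b (by omega) (by omega) hab))
  rw [Fintype.card_fin] at this
  omega
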